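/- Let V be a simple Euclidean Jordan algebra of dimension n with cone of squares K, let α ∈ K, and let B : V → V be a linear map satisfying ⟨B(x),u⟩ ≥ 0 for all u,x ∈ K with ⟨u,x⟩ = 0. Then for every t > 0 the element σ_t := 2 ∫₀ᵗ exp(sB)(α) ds (where exp(sB) is the operator exponential and the integral is a Bochner integral) lies in the interior of K if and only if the only u ∈ V with L(B^k(α))u = 0 for all k = 0,1,…,n−1 is u = 0 (equivalently, the stacked linear map (L(α), L(B(α)), …, L(B^{n−1}(α))) has rank n). In particular, σ_t lies in the interior of K for one t > 0 if and only if it does so for all t > 0. -/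

import Mathlib

open MeasureTheory Filter Set
open scoped RealInnerProductSpace ENNReal Topology

/-- A Euclidean Jordan algebra structure on a finite-dimensional real inner product
space `V`: a commutative bilinear product with unit satisfying the Jordan identity,
compatible with the inner product. -/
structure EuclideanJordanAlgebra (V : Type*) [NormedAddCommGroup V]
    [InnerProductSpace ℝ V] [FiniteDimensional ℝ V] where
  mul : V →ₗ[ℝ] V →ₗ[ℝ] V
  comm : ∀ x y : V, mul x y = mul y x
  jordan : ∀ x y : V, mul (mul x x) (mul x y) = mul x (mul (mul x x) y)
  e : V
  unit : ∀ x : V, mul e x = x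
  compat : ∀ x y z : V, ⟪mul x y, z⟫ = ⟪y, mul x z⟫

namespace EuclideanJordanAlgebra

variable {V : Type*} [NormedAddCommGroup V] [InnerProductSpace ℝ V]
  [FiniteDimensional ℝ V] (J : EuclideanJordanAlgebra V)

/-- The left multiplication operator `L(x) y = x ∘ y`. -/
def L (x : V) : V →ₗ[ℝ] V := J.mul x

/-- The quadratic representation `P(x) = 2 L(x)² − L(x ∘ x)`. -/
def P (x : V) : V →ₗ[ℝ] V := (2 : ℝ) • (J.L x ∘ₗ J.L x) - J.L (J.mul x x)

/-- The cone of squares `K = {x ∘ x : x ∈ V}`. -/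
def cone : Set V := {y | ∃ x : V, y = J.mul x x}

/-- The Jordan algebra is simple: it is nontrivial and its only ideals are `⊥` and
`⊤`. -/
def IsSimple : Prop :=
  Nontrivial V ∧
    ∀ I : Submodule ℝ V, (∀ x : V, ∀ y ∈ I, J.mul x y ∈ I) → I = ⊥ ∨ I = ⊤

/-- `p` is an idempotent: `p ∘ p = p`. -/
def IsIdempotent (p : V) : Prop := J.mul p p = p

/-- `p` is a primitive idempotent: a nonzero idempotent that is not the sum of two
nonzero orthogonal idempotents. -/
def IsPrimitive (p : V) : Prop :=
  J.IsIdempotent p ∧ p ≠ 0 ∧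
    ¬∃ q₁ q₂ : V, J.IsIdempotent q₁ ∧ J.IsIdempotent q₂ ∧ q₁ ≠ 0 ∧ q₂ ≠ 0 ∧
      J.mul q₁ q₂ = 0 ∧ p = q₁ + q₂

/-- A Jordan frame: a family of pairwise orthogonal primitive idempotents summing to
the unit. -/
def IsJordanFrame {k : ℕ} (p : Fin k → V) : Prop :=
  (∀ i, J.IsPrimitive (p i)) ∧ (∀ i j, i ≠ j → J.mul (p i) (p j) = 0) ∧
    (∑ i, p i) = J.e

/-- The Jordan algebra has rank `r`: there is a Jordan frame of cardinality `r` and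
every Jordan frame has cardinality `r`. -/
def HasRank (r : ℕ) : Prop :=
  (∃ p : Fin r → V, J.IsJordanFrame p) ∧
    ∀ (k : ℕ) (p : Fin k → V), J.IsJordanFrame p → k = r

/-- The off-diagonal Peirce space `V_{ab}` of two idempotents: the common
`1/2`-eigenspace of `L(a)` and `L(b)`. -/
noncomputable def peirceSpace (a b : V) : Submodule ℝ V :=
  LinearMap.ker (J.mul a - (1/2 : ℝ) • LinearMap.id) ⊓
    LinearMap.ker (J.mul b - (1/2 : ℝ) • LinearMap.id)

/-- The Jordan algebra has Peirce invariant `d`: all off-diagonal Peirce spaces of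
Jordan frames have dimension `d`. -/
def HasPeirceInvariant (d : ℕ) : Prop :=
  ∀ (k : ℕ) (p : Fin k → V), J.IsJordanFrame p → ∀ i j : Fin k, i ≠ j →
    Module.finrank ℝ (J.peirceSpace (p i) (p j)) = d

/-- The inner product is the trace form, normalized so that `⟪p, p⟫ = 1` for every
primitive idempotent `p`. -/
def TraceNormalized : Prop := ∀ p : V, J.IsPrimitive p → ⟪p, p⟫ = 1

end EuclideanJordanAlgebra

namespace EuclideanJordanAlgebra

section helpers

variable {V : Type*} [NormedAddCommGroup V] [InnerProductSpace ℝ V]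
  [FiniteDimensional ℝ V] (J : EuclideanJordanAlgebra V)

open Polynomial in
lemma aeval_eq_of_eval_eq (T : V →ₗ[ℝ] V) (hT : T.IsSymmetric) (p q : ℝ[X])
    (h : ∀ μ, Module.End.HasEigenvalue T μ → p.eval μ = q.eval μ) :
    aeval T p = aeval T q := by
  refine (hT.eigenvectorBasis rfl).toBasis.ext fun i => ?_
  have hv := hT.hasEigenvector_eigenvectorBasis rfl i
  have hl := hT.hasEigenvalue_eigenvalues rfl i
  have h1 := Module.End.aeval_apply_of_hasEigenvector (p := p) hv
  have h2 := Module.End.aeval_apply_of_hasEigenvector (p := q) hv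
  simp only [OrthonormalBasis.coe_toBasis]
  rw [h1, h2, h _ hl]

lemma psd_of_eigen (T : V →ₗ[ℝ] V) (hT : T.IsSymmetric)
    (h : ∀ μ, Module.End.HasEigenvalue T μ → 0 ≤ μ) (w : V) : 0 ≤ ⟪T w, w⟫ := by
  rw [hT w w, ← (hT.eigenvectorBasis rfl).sum_inner_mul_inner w (T w)]
  refine Finset.sum_nonneg fun i _ => ?_
  have hl := h _ (hT.hasEigenvalue_eigenvalues rfl i)
  rw [← hT, hT.apply_eigenvectorBasis rfl i, real_inner_comm]
  simp only [inner_smul_left]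
  have := mul_self_nonneg (⟪hT.eigenvectorBasis rfl i, w⟫)
  simp only [RCLike.ofReal_real_eq_id, id, conj_trivial] at *
  nlinarith

lemma ker_of_psd (T : V →ₗ[ℝ] V) (hT : T.IsSymmetric)
    (h : ∀ w, 0 ≤ ⟪T w, w⟫) (w : V) (hw : ⟪T w, w⟫ = 0) : T w = 0 := by
  set v := T w with hv
  have hb := h v
  set b := ⟪T v, v⟫ with hbd
  set a := ⟪v, v⟫ with ha
  set ε := a / (b + 1) with hε
  have hae : a = ε * (b + 1) := by rw [hε]; field_simp
  have h1 := h (w + (-ε) • v)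
  have e1 : ⟪T v, w⟫ = a := by rw [hT, ha]
  have e2 : ⟪T (w + (-ε) • v), w + (-ε) • v⟫ = -2 * ε * a + ε ^ 2 * b := by
    simp only [map_add, map_smul, inner_add_left, inner_add_right, real_inner_smul_left,
      real_inner_smul_right]
    rw [e1, ← hv, hw, ← hbd, ← ha]; ring
  rw [e2, hae] at h1
  have hε0 : ε = 0 := by
    have : ε ^ 2 * (b + 2) ≤ 0 := by nlinarith
    have h3 : ε ^ 2 ≤ 0 := by nlinarith [sq_nonneg ε]
    exact pow_eq_zero_iff (two_ne_zero) |>.1 (le_antisymm h3 (sq_nonneg ε))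
  rw [hε0, zero_mul] at hae
  exact inner_self_eq_zero.1 hae

lemma mul_symm (x : V) : (J.mul x).IsSymmetric := fun y z => J.compat x y z

lemma mul_e (x : V) : J.mul x J.e = x := by rw [J.comm, J.unit]

/-- linearized Jordan identity -/
lemma lin_jordan (x y z : V) :
    J.mul (J.mul (J.mul x x) y) z = (2 : ℝ) • J.mul (J.mul x y) (J.mul x z)
      + J.mul (J.mul x x) (J.mul y z) - (2 : ℝ) • J.mul x (J.mul y (J.mul x z)) := by
  have h0 := J.jordan x y
  have hz := J.jordan z y
  have h1 := J.jordan (x + z) y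
  have h2 := J.jordan (x - z) y
  simp only [map_add, map_sub, LinearMap.add_apply, LinearMap.sub_apply] at h1 h2
  rw [J.comm z x] at h1 h2
  have c1 := J.comm (J.mul (J.mul x x) y) z
  have c2 := J.comm (J.mul x y) (J.mul x z)
  have c3 := J.comm y (J.mul x z)
  have c4 := J.comm y z
  rw [c1, c2, c3, c4]
  have key : (2 : ℝ) • (J.mul z (J.mul (J.mul x x) y)) = (2 : ℝ) • ((2 : ℝ) • J.mul (J.mul x z) (J.mul x y)
      + J.mul (J.mul x x) (J.mul z y) - (2 : ℝ) • J.mul x (J.mul (J.mul x z) y)) := by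
    linear_combination (norm := module) (-1 : ℝ) • h1 + h2 + (2 : ℝ) • hz
  exact smul_right_injective V (two_ne_zero) key

/-- powers -/
lemma pow_facts (x : V) (m : ℕ) :
    Commute (J.mul (((J.mul x) ^ m) J.e)) (J.mul x) := by
  have hc : Commute (J.mul (J.mul x x)) (J.mul x) := by
    ext y; exact J.jordan x y
  have hsq : ∀ n : ℕ, ((J.mul x) ^ (n + 2)) J.e = J.mul (J.mul x x) (((J.mul x) ^ n) J.e) := by
    intro n
    have := congrArg (fun f : Module.End ℝ V => f J.e) (hc.pow_right n).eq
    simp only [Module.End.mul_apply] at this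
    rw [this, J.mul_e, pow_add]
    simp [pow_two, J.mul_e]
  induction m using Nat.strong_induction_on with
  | _ m ih =>
    match m with
    | 0 =>
      have : J.mul (((J.mul x) ^ 0) J.e) = 1 := by ext y; simp [J.unit]
      rw [this]; exact Commute.one_left _
    | 1 => simp [J.mul_e]
    | n + 2 =>
      have i0 := ih n (by omega)
      have i1 := ih (n + 1) (by omega)
      have : J.mul (((J.mul x) ^ (n + 2)) J.e) =
          (2 : ℝ) • (J.mul (((J.mul x) ^ (n + 1)) J.e) * J.mul x)
          + J.mul (J.mul x x) * J.mul (((J.mul x) ^ n) J.e)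
          - (2 : ℝ) • (J.mul x * (J.mul (((J.mul x) ^ n) J.e) * J.mul x)) := by
        ext z
        rw [hsq, lin_jordan]
        simp [pow_succ']
      rw [this]
      exact (((i1.mul_left (Commute.refl _)).smul_left _).add_left (hc.mul_left i0)).sub_left
        (((Commute.refl _).mul_left (i0.mul_left (Commute.refl _))).smul_left _)

open Polynomial in
lemma aeval_mul_e (x : V) (p q : ℝ[X]) :
    J.mul (aeval (J.mul x) p J.e) (aeval (J.mul x) q J.e) = aeval (J.mul x) (p * q) J.e := by
  induction p using Polynomial.induction_on' with
  | add p₁ p₂ h1 h2 => simp [add_mul, h1, h2]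
  | monomial m a =>
    induction q using Polynomial.induction_on' with
    | add p₁ p₂ h1 h2 => rw [mul_add, map_add, map_add, LinearMap.add_apply, LinearMap.add_apply,
        map_add, h1, h2]
    | monomial k b =>
      have := congrArg (fun f : Module.End ℝ V => f J.e) ((J.pow_facts x m).pow_right k).eq
      simp only [Module.End.mul_apply] at this
      rw [J.mul_e] at this
      simp only [monomial_mul_monomial, aeval_monomial, Module.End.mul_apply,
        Module.algebraMap_end_apply, map_smul, LinearMap.smul_apply, this]
      rw [add_comm m k, pow_add, Module.End.mul_apply, smul_smul, mul_comm]

open Polynomial in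
lemma spectral (x : V) : ∃ (S : Finset ℝ) (c : ℝ → V),
    (∀ μ ∈ S, Module.End.HasEigenvalue (J.mul x) μ) ∧
    (∀ μ ∈ S, J.mul (c μ) (c μ) = c μ) ∧
    (∀ μ ∈ S, ∀ ν ∈ S, μ ≠ ν → J.mul (c μ) (c ν) = 0) ∧
    x = ∑ μ ∈ S, μ • c μ := by
  classical
  have hT := J.mul_symm x
  set S : Finset ℝ := Finset.univ.image (hT.eigenvalues rfl) with hS
  have hmem : ∀ μ, μ ∈ S ↔ Module.End.HasEigenvalue (J.mul x) μ := by
    intro μ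
    constructor
    · intro h
      obtain ⟨i, -, rfl⟩ := Finset.mem_image.1 h
      exact hT.hasEigenvalue_eigenvalues rfl i
    · intro h
      obtain ⟨i, hi⟩ := hT.exists_eigenvalues_eq rfl h
      exact Finset.mem_image.2 ⟨i, Finset.mem_univ _, hi⟩
  have ev : ∀ μ ∈ S, ∀ ν ∈ S, (Lagrange.basis S id μ).eval ν = if μ = ν then (1 : ℝ) else 0 := by
    intro μ hμ ν hν
    split_ifs with h
    · subst h
      exact Lagrange.eval_basis_self (v := id) (fun a _ b _ h => h) hμ
    · exact Lagrange.eval_basis_of_ne (v := id) h hν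
  refine ⟨S, fun μ => aeval (J.mul x) (Lagrange.basis S id μ) J.e, fun μ hμ => (hmem μ).1 hμ,
    ?_, ?_, ?_⟩
  · intro μ hμ
    rw [aeval_mul_e]
    congr 1
    apply aeval_eq_of_eval_eq _ hT
    intro ν hν
    rw [eval_mul, ev μ hμ ν ((hmem ν).2 hν)]
    split_ifs <;> simp
  · intro μ hμ ν hν hne
    rw [aeval_mul_e]
    have : aeval (J.mul x) (Lagrange.basis S id μ * Lagrange.basis S id ν) = aeval (J.mul x) (0 : ℝ[X]) := by
      apply aeval_eq_of_eval_eq _ hT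
      intro l hl
      rw [eval_mul, ev μ hμ l ((hmem l).2 hl), ev ν hν l ((hmem l).2 hl)]
      split_ifs with h1 h2
      · exact absurd (h1.trans h2.symm) hne
      all_goals simp
    rw [this]; simp
  · have : aeval (J.mul x) (X : ℝ[X]) = aeval (J.mul x) (∑ μ ∈ S, μ • Lagrange.basis S id μ) := by
      apply aeval_eq_of_eval_eq _ hT
      intro l hl
      have hl' := (hmem l).2 hl
      rw [eval_finsetSum, Finset.sum_congr rfl (fun μ hμ => by rw [eval_smul, ev μ hμ l hl'])]
      simp [hl']
    have h2 := congrArg (fun f : Module.End ℝ V => f J.e) this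
    simpa [J.mul_e] using h2

lemma sum_mul_sum (S : Finset ℝ) (c : ℝ → V) (h1 : ∀ μ ∈ S, J.mul (c μ) (c μ) = c μ)
    (h2 : ∀ μ ∈ S, ∀ ν ∈ S, μ ≠ ν → J.mul (c μ) (c ν) = 0) (f : ℝ → ℝ) :
    J.mul (∑ μ ∈ S, f μ • c μ) (∑ μ ∈ S, f μ • c μ) = ∑ μ ∈ S, (f μ * f μ) • c μ := by
  rw [map_sum J.mul, LinearMap.sum_apply]
  refine Finset.sum_congr rfl fun μ hμ => ?_
  rw [map_sum, Finset.sum_eq_single μ]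
  · simp [h1 μ hμ, smul_smul]
  · intro ν hν hne
    simp [h2 μ hμ ν hν hne.symm]
  · intro h; exact absurd hμ h

lemma idem_psd (c : V) (hc : J.mul c c = c) (w : V) : 0 ≤ ⟪J.mul c w, w⟫ := by
  refine psd_of_eigen _ (J.mul_symm c) ?_ w
  intro μ hμ
  obtain ⟨v, hv⟩ := hμ.exists_hasEigenvector
  have h1 : J.mul c v = μ • v := hv.apply_eq_smul
  have h := J.lin_jordan c c v
  rw [hc] at h
  simp only [h1, hc, map_smul, smul_smul, ← add_smul, ← sub_smul] at h
  have h3 : (μ - (2 * (μ * μ) + μ * μ - 2 * (μ * (μ * μ)))) • v = 0 := by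
    rw [sub_smul, sub_eq_zero]
    convert h using 2
    ring
  have h4 := (smul_eq_zero.1 h3).resolve_right hv.2
  by_contra hneg
  push Not at hneg
  have : μ * ((1 - μ) * (1 - 2 * μ)) = 0 := by linarith
  have h5 : 0 < (1 - μ) * (1 - 2 * μ) := by apply mul_pos <;> linarith
  nlinarith

lemma inner_sq (x w : V) : ⟪x, J.mul w w⟫ = ⟪J.mul x w, w⟫ := by
  rw [real_inner_comm, J.compat, J.comm w x, real_inner_comm]

lemma sq_psd (x w : V) : 0 ≤ ⟪J.mul (J.mul x x) w, w⟫ := by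
  obtain ⟨S, c, -, h1, h2, h3⟩ := J.spectral x
  have := J.sum_mul_sum S c h1 h2 id
  simp only [id] at this
  rw [← h3] at this
  rw [this, map_sum, LinearMap.sum_apply, sum_inner]
  refine Finset.sum_nonneg fun μ hμ => ?_
  rw [map_smul, LinearMap.smul_apply, real_inner_smul_left]
  exact mul_nonneg (mul_self_nonneg _) (J.idem_psd _ (h1 μ hμ) w)

lemma mem_cone_iff (x : V) : x ∈ J.cone ↔ ∀ w, 0 ≤ ⟪x, J.mul w w⟫ := by
  constructor
  · rintro ⟨y, rfl⟩ w
    rw [inner_sq]; exact J.sq_psd y w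
  · intro h
    obtain ⟨S, c, h0, h1, h2, h3⟩ := J.spectral x
    refine ⟨∑ μ ∈ S, Real.sqrt μ • c μ, ?_⟩
    rw [J.sum_mul_sum S c h1 h2]
    nth_rw 1 [h3]
    refine Finset.sum_congr rfl fun μ hμ => ?_
    have : 0 ≤ μ := by
      obtain ⟨v, hv⟩ := (h0 μ hμ).exists_hasEigenvector
      have h5 := h v
      rw [inner_sq, hv.apply_eq_smul, real_inner_smul_left] at h5
      have : 0 < ⟪v, v⟫ := real_inner_self_pos.2 hv.2
      exact nonneg_of_mul_nonneg_left h5 this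
    rw [Real.mul_self_sqrt this]

lemma mul_eq_zero_of_inner (u v : V) (hu : u ∈ J.cone) (hv : v ∈ J.cone) (h : ⟪u, v⟫ = 0) :
    J.mul u v = 0 := by
  obtain ⟨w, rfl⟩ := hv
  obtain ⟨S, c, -, h1, h2, h3⟩ := J.spectral w
  have := J.sum_mul_sum S c h1 h2 id
  simp only [id] at this
  rw [← h3] at this
  have hps : ∀ w, 0 ≤ ⟪J.mul u w, w⟫ := fun w => by
    rw [← inner_sq]; exact (J.mem_cone_iff u).1 hu w
  have hsm : ∀ μ ∈ S, (μ * μ) • c μ = J.mul (μ • c μ) (μ • c μ) := fun μ hμ => by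
    simp [smul_smul, h1 μ hμ]
  rw [this, inner_sum, Finset.sum_eq_zero_iff_of_nonneg] at h
  · rw [this, map_sum]
    refine Finset.sum_eq_zero fun μ hμ => ?_
    have h5 := h μ hμ
    rw [hsm μ hμ, inner_sq] at h5
    have h6 := ker_of_psd _ (J.mul_symm u) hps _ h5
    rw [mul_smul, map_smul, h6, smul_zero]
  · intro μ hμ
    rw [hsm μ hμ, inner_sq]
    exact hps _

lemma sq_eq_zero (w : V) (h : J.mul w w = 0) : w = 0 := by
  have : ⟪J.e, J.mul w w⟫ = ⟪w, w⟫ := by rw [inner_sq, J.unit]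
  rw [h, inner_zero_right] at this
  exact inner_self_eq_zero.1 this.symm

lemma sq_mem (w : V) : J.mul w w ∈ J.cone := ⟨w, rfl⟩

lemma cone_closed : IsClosed J.cone := by
  have : J.cone = ⋂ w, {x | 0 ≤ ⟪x, J.mul w w⟫} := by
    ext x; simp [J.mem_cone_iff]
  rw [this]
  exact isClosed_iInter fun w => isClosed_le continuous_const (by fun_prop)

lemma mul_bound : ∃ C : ℝ, 0 ≤ C ∧ ∀ d w : V, |⟪d, J.mul w w⟫| ≤ C * ‖d‖ * (‖w‖ * ‖w‖) := by
  refine ⟨‖J.mul.toContinuousBilinearMap‖, by positivity, fun d w => ?_⟩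
  rw [inner_sq]
  refine (abs_real_inner_le_norm _ _).trans ?_
  have := J.mul.toContinuousBilinearMap.le_opNorm₂ d w
  rw [LinearMap.toContinuousBilinearMap_apply] at this
  rw [← mul_assoc]
  gcongr

lemma interior_of_ker (z : V) (hz : z ∈ J.cone) (h : ∀ w, J.mul z w = 0 → w = 0) :
    z ∈ interior J.cone := by
  obtain ⟨C, hC, hCb⟩ := J.mul_bound
  have hps : ∀ w, 0 ≤ ⟪J.mul z w, w⟫ := fun w => by
    rw [← inner_sq]; exact (J.mem_cone_iff z).1 hz w
  have hcont : Continuous fun w : V => ⟪z, J.mul w w⟫ := by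
    simp only [inner_sq]
    have : Continuous (J.mul z) := LinearMap.continuous_of_finiteDimensional _
    fun_prop
  obtain ⟨m, hm, hmb⟩ : ∃ m > 0, ∀ w, m * (‖w‖ * ‖w‖) ≤ ⟪z, J.mul w w⟫ := by
    rcases subsingleton_or_nontrivial V with hV | hV
    · refine ⟨1, one_pos, fun w => ?_⟩
      rw [Subsingleton.elim w 0]; simp
    · obtain ⟨w0, hw0, hmin⟩ := (isCompact_sphere (0 : V) 1).exists_isMinOn
        (NormedSpace.sphere_nonempty.2 zero_le_one) hcont.continuousOn
      refine ⟨⟪z, J.mul w0 w0⟫, ?_, fun w => ?_⟩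
      · rw [inner_sq]
        refine lt_of_le_of_ne (hps _) fun h0 => ?_
        have := h _ (ker_of_psd _ (J.mul_symm z) hps _ h0.symm)
        simp [this] at hw0
      · rcases eq_or_ne w 0 with rfl | hw
        · simp
        · have hn : 0 < ‖w‖ := norm_pos_iff.2 hw
          have := hmin (a := ‖w‖⁻¹ • w) (by simp [norm_smul, hn.ne'])
          simp only [mem_ofPred_eq, map_smul, LinearMap.smul_apply, inner_smul_right] at this
          have h2 : ‖w‖⁻¹ * (‖w‖⁻¹ * ⟪z, J.mul w w⟫) * (‖w‖ * ‖w‖) = ⟪z, J.mul w w⟫ := by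
            field_simp
          calc _ ≤ ‖w‖⁻¹ * (‖w‖⁻¹ * ⟪z, J.mul w w⟫) * (‖w‖ * ‖w‖) := by gcongr
            _ = _ := h2
  rw [mem_interior_iff_mem_nhds, Metric.mem_nhds_iff]
  refine ⟨m / (C + 1), by positivity, fun y hy => ?_⟩
  rw [mem_ball_iff_norm, lt_div_iff₀ (by positivity)] at hy
  rw [J.mem_cone_iff]
  intro w
  have e1 : ⟪y, J.mul w w⟫ = ⟪z, J.mul w w⟫ + ⟪y - z, J.mul w w⟫ := by
    rw [inner_sub_left]; ring
  have e2 := (abs_le.1 (hCb (y - z) w)).1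
  have e3 := hmb w
  have e4 : C * ‖y - z‖ ≤ m := by nlinarith [norm_nonneg (y - z)]
  have e5 := mul_le_mul_of_nonneg_right e4 (mul_self_nonneg ‖w‖)
  linarith

lemma ker_of_interior (z : V) (hz : z ∈ interior J.cone) (u : V) (h : J.mul z u = 0) : u = 0 := by
  have hcont : Tendsto (fun ε : ℝ => z - ε • J.e) (𝓝[>] 0) (𝓝 z) := by
    have : Continuous (fun ε : ℝ => z - ε • J.e) := by fun_prop
    have h2 := this.tendsto 0
    simp only [zero_smul, sub_zero] at h2
    exact h2.mono_left nhdsWithin_le_nhds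
  obtain ⟨ε, hε, hpos⟩ := ((hcont.eventually (mem_interior_iff_mem_nhds.1 hz)).and
    self_mem_nhdsWithin).exists
  have h1 := (J.mem_cone_iff _).1 hε u
  rw [inner_sq, map_sub, LinearMap.sub_apply, h, map_smul, LinearMap.smul_apply, J.unit, zero_sub,
    inner_neg_left, real_inner_smul_left] at h1
  by_contra hne
  have := mul_pos (show 0 < ε from hpos) (real_inner_self_pos.2 hne)
  linarith

lemma hasDerivAt_flow (B : V →L[ℝ] V) (x : V) (s : ℝ) :
    HasDerivAt (fun s : ℝ => (NormedSpace.exp (s • B)) x) (B ((NormedSpace.exp (s • B)) x)) s := by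
  have h := hasDerivAt_exp_smul_const' (𝕂 := ℝ) B s
  simpa using h.clm_apply (hasDerivAt_const s x)

end helpers

end EuclideanJordanAlgebra
namespace EuclideanJordanAlgebra

section helpers2

variable {V : Type*} [NormedAddCommGroup V] [InnerProductSpace ℝ V]
  [FiniteDimensional ℝ V] (J : EuclideanJordanAlgebra V)

lemma continuous_flow (B : V →L[ℝ] V) (x : V) :
    Continuous (fun s : ℝ => (NormedSpace.exp (s • B)) x) :=
  continuous_iff_continuousAt.2 fun s => (hasDerivAt_flow B x s).continuousAt

lemma deriv_nonpos_of (f : ℝ → ℝ) (f' s : ℝ) (hs : 0 < s) (hf : HasDerivAt f f' s)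
    (h0 : f s = 0) (hpos : ∀ r, 0 ≤ r → r < s → 0 ≤ f r) : f' ≤ 0 := by
  have h1 : Tendsto (slope f s) (𝓝[<] s) (𝓝 f') :=
    (hasDerivAt_iff_tendsto_slope.1 hf).mono_left
      (nhdsWithin_mono _ fun r (hr : r < s) => hr.ne)
  refine le_of_tendsto h1 ?_
  have h2 : ∀ᶠ r in 𝓝[<] s, r ∈ Ioo 0 s := Ioo_mem_nhdsLT hs
  filter_upwards [h2] with r hr
  rw [slope_def_field, h0, sub_zero]
  exact div_nonpos_of_nonneg_of_nonpos (hpos r hr.1.le hr.2) (by linarith [hr.2])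

lemma flow_mem (B : V →L[ℝ] V)
    (hB : ∀ u ∈ J.cone, ∀ x ∈ J.cone, ⟪u, x⟫ = 0 → 0 ≤ ⟪B x, u⟫)
    (x : V) (hx : x ∈ J.cone) (s : ℝ) (hs : 0 ≤ s) :
    (NormedSpace.exp (s • B)) x ∈ J.cone := by
  obtain ⟨C, hC, hCb⟩ := J.mul_bound
  set m := C * ‖B J.e‖ + 1 with hm
  have he : ∀ w, ⟪J.e, J.mul w w⟫ = ‖w‖ * ‖w‖ := fun w => by
    rw [inner_sq, J.unit, real_inner_self_eq_norm_mul_norm]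
  have main : ∀ ε : ℝ, 0 < ε →
      (NormedSpace.exp (s • B)) x + (ε * Real.exp (m * s)) • J.e ∈ J.cone := by
    intro ε hε
    set z : ℝ → V := fun r => (NormedSpace.exp (r • B)) x + (ε * Real.exp (m * r)) • J.e with hz
    have hzd : ∀ r, HasDerivAt z (B ((NormedSpace.exp (r • B)) x)
        + (ε * (Real.exp (m * r) * m)) • J.e) r := by
      intro r
      refine (hasDerivAt_flow B x r).add ?_
      have h1 : HasDerivAt (fun r => m * r) m r := by
        simpa using (hasDerivAt_id r).const_mul m
      exact ((h1.exp).const_mul ε).smul_const J.e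
    have hzc : Continuous z := continuous_iff_continuousAt.2 fun r => (hzd r).continuousAt
    by_contra hcon
    set S : Set ℝ := {r | 0 ≤ r ∧ z r ∉ J.cone} with hS
    have hSn : S.Nonempty := ⟨s, hs, hcon⟩
    have hSb : BddBelow S := ⟨0, fun r hr => hr.1⟩
    set r0 := sInf S with hr0
    have hr00 : 0 ≤ r0 := le_csInf hSn fun r hr => hr.1
    have hbefore : ∀ r, 0 ≤ r → r < r0 → z r ∈ J.cone := by
      intro r h1 h2
      by_contra h3
      exact absurd (csInf_le hSb (show r ∈ S from ⟨h1, h3⟩)) (not_le.2 h2)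
    have hz0 : z 0 ∈ J.cone := by
      rw [J.mem_cone_iff]
      intro w
      have := (J.mem_cone_iff x).1 hx w
      simp only [hz, zero_smul, NormedSpace.exp_zero, mul_zero, Real.exp_zero, mul_one,
        one_apply_eq_self, inner_add_left, real_inner_smul_left, he]
      positivity
    have hr0K : z r0 ∈ J.cone := by
      rcases hr00.eq_or_lt with h | h
      · rw [← h]; exact hz0
      · have ht : Tendsto z (𝓝[<] r0) (𝓝 (z r0)) := (hzc.tendsto r0).mono_left nhdsWithin_le_nhds
        refine J.cone_closed.mem_of_tendsto ht ?_
        have h2 : ∀ᶠ r in 𝓝[<] r0, r ∈ Ioo 0 r0 := Ioo_mem_nhdsLT h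
        filter_upwards [h2] with r hr
        exact hbefore r hr.1.le hr.2
    have hnint : z r0 ∉ interior J.cone := by
      intro hint
      have h1 : ∀ᶠ r in 𝓝 r0, z r ∈ J.cone :=
        hzc.continuousAt.eventually (mem_interior_iff_mem_nhds.1 hint)
      obtain ⟨δ, hδ, hball⟩ := Metric.eventually_nhds_iff.1 h1
      obtain ⟨r, hrS, hr⟩ := exists_lt_of_csInf_lt hSn (show sInf S < r0 + δ by linarith)
      have := csInf_le hSb hrS
      refine hrS.2 (hball ?_)
      rw [Real.dist_eq, abs_lt]
      constructor <;> linarith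
    obtain ⟨w, hw, hw0⟩ : ∃ w, J.mul (z r0) w = 0 ∧ w ≠ 0 := by
      by_contra hno
      push Not at hno
      exact hnint (J.interior_of_ker _ hr0K hno)
    have hwp : 0 < ‖w‖ := norm_pos_iff.2 hw0
    have horth : ⟪z r0, J.mul w w⟫ = 0 := by rw [inner_sq, hw, inner_zero_left]
    have hr0pos : 0 < r0 := by
      rcases hr00.eq_or_lt with h | h
      · exfalso
        rw [← h] at horth
        have := (J.mem_cone_iff x).1 hx w
        simp only [hz, zero_smul, NormedSpace.exp_zero, mul_zero, Real.exp_zero, mul_one,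
          one_apply_eq_self, inner_add_left, real_inner_smul_left, he] at horth
        have : 0 < ε * (‖w‖ * ‖w‖) := by positivity
        linarith
      · exact h
    have hd : HasDerivAt (fun r => ⟪z r, J.mul w w⟫) _ r0 :=
      (hzd r0).inner ℝ (hasDerivAt_const r0 (J.mul w w))
    have hle := deriv_nonpos_of _ _ r0 hr0pos hd horth
      (fun r h1 h2 => (J.mem_cone_iff _).1 (hbefore r h1 h2) w)
    have hBz : B ((NormedSpace.exp (r0 • B)) x) =
        B (z r0) - (ε * Real.exp (m * r0)) • B J.e := by
      simp [hz]
    have hcp := hB _ (J.sq_mem w) _ hr0K (by rw [real_inner_comm]; exact horth)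
    rw [hBz, inner_zero_right, zero_add, inner_add_left, inner_sub_left, real_inner_smul_left,
      real_inner_smul_left, he] at hle
    have hb := (abs_le.1 (hCb (B J.e) w)).2
    have hE : 0 < ε * Real.exp (m * r0) := by positivity
    have hww : 0 < ‖w‖ * ‖w‖ := by positivity
    have h3 : 0 < m * (‖w‖ * ‖w‖) - ⟪B J.e, J.mul w w⟫ := by
      rw [hm]; nlinarith
    have := mul_pos hE h3
    nlinarith
  have hlim : Tendsto (fun ε : ℝ => (NormedSpace.exp (s • B)) x + (ε * Real.exp (m * s)) • J.e)
      (𝓝[>] 0) (𝓝 ((NormedSpace.exp (s • B)) x)) := by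
    have hc : Continuous
        (fun ε : ℝ => (NormedSpace.exp (s • B)) x + (ε * Real.exp (m * s)) • J.e) := by fun_prop
    have h2 := hc.tendsto 0
    simp only [zero_mul, zero_smul, add_zero] at h2
    exact h2.mono_left nhdsWithin_le_nhds
  refine J.cone_closed.mem_of_tendsto hlim ?_
  filter_upwards [self_mem_nhdsWithin] with ε hε
  exact main ε hε

lemma flow_inner_integral (B : V →L[ℝ] V) (x u : V) (t : ℝ) :
    ⟪∫ s in (0 : ℝ)..t, (NormedSpace.exp (s • B)) x, u⟫
      = ∫ s in (0 : ℝ)..t, ⟪(NormedSpace.exp (s • B)) x, u⟫ := by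
  have := (innerSL ℝ u).intervalIntegral_comp_comm
    ((continuous_flow B x).intervalIntegrable (μ := volume) 0 t)
  simp only [innerSL_apply_apply] at this
  rw [real_inner_comm, ← this]
  simp only [real_inner_comm]

open Polynomial in
lemma all_pow (n : ℕ) (hn : Module.finrank ℝ V = n) (α : V) (B : V →L[ℝ] V) (u : V)
    (h : ∀ k : ℕ, k < n → J.mul ((B ^ k) α) u = 0) (k : ℕ) : J.mul ((B ^ k) α) u = 0 := by
  have hk : ∀ k, (B ^ k) α = ((B : V →ₗ[ℝ] V) ^ k) α := by
    intro k
    induction k with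
    | zero => simp
    | succ k ih => rw [pow_succ', pow_succ']; simp [ih]
  rw [hk, LinearMap.pow_eq_aeval_mod_charpoly, aeval_eq_sum_range, LinearMap.sum_apply, map_sum,
    LinearMap.sum_apply]
  refine Finset.sum_eq_zero fun i hi => ?_
  rw [LinearMap.smul_apply, ← hk, map_smul, LinearMap.smul_apply]
  by_cases hin : i < n
  · rw [h i hin, smul_zero]
  · rw [coeff_eq_zero_of_degree_lt, zero_smul]
    refine (degree_modByMonic_lt _ (LinearMap.charpoly_monic _)).trans_le ?_
    rw [degree_eq_natDegree (LinearMap.charpoly_monic _).ne_zero, LinearMap.charpoly_natDegree, hn]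
    exact_mod_cast not_lt.1 hin

lemma flow_kill (α : V) (B : V →L[ℝ] V) (u : V)
    (h : ∀ k : ℕ, J.mul ((B ^ k) α) u = 0) (s : ℝ) :
    J.mul ((NormedSpace.exp (s • B)) α) u = 0 := by
  have h1 := NormedSpace.exp_series_hasSum_exp' (𝕂 := ℝ) (s • B)
  let Λ : (V →L[ℝ] V) →L[ℝ] V :=
    ((J.mul u).toContinuousLinearMap).comp (ContinuousLinearMap.apply ℝ V α)
  have h2 := h1.mapL Λ
  have h3 : (fun n : ℕ => Λ (((n.factorial : ℝ)⁻¹) • (s • B) ^ n)) = fun _ => 0 := by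
    funext k
    have := h k
    rw [J.comm] at this
    have e : Λ (B ^ k) = J.mul u ((B ^ k) α) := rfl
    rw [smul_pow, map_smul, map_smul, e, this, smul_zero, smul_zero]
  rw [h3] at h2
  have := h2.unique hasSum_zero
  rw [J.comm]
  simpa [Λ] using this

lemma iff_rank (n : ℕ) (hn : Module.finrank ℝ V = n)
    (α : V) (hα : α ∈ J.cone) (B : V →L[ℝ] V)
    (hB : ∀ u ∈ J.cone, ∀ x ∈ J.cone, ⟪u, x⟫ = 0 → 0 ≤ ⟪B x, u⟫) (t : ℝ) (ht : 0 < t) :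
    ((2 : ℝ) • ∫ s in (0 : ℝ)..t, (NormedSpace.exp (s • B)) α) ∈ interior J.cone ↔
        ∀ u : V, (∀ k : ℕ, k < n → J.mul ((B ^ k) α) u = 0) → u = 0 := by
  have hcf := continuous_flow B α
  constructor
  · intro hint u hu
    refine J.ker_of_interior _ hint u ?_
    have h1 := J.flow_kill α B u (J.all_pow n hn α B u hu)
    have := ((J.mul u).toContinuousLinearMap).intervalIntegral_comp_comm
      (hcf.intervalIntegrable (μ := volume) 0 t)
    simp only [LinearMap.coe_toContinuousLinearMap'] at this
    rw [J.comm, map_smul, ← this]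
    simp [J.comm u, h1]
  · intro hr
    refine J.interior_of_ker _ ?_ ?_
    · rw [J.mem_cone_iff]
      intro w
      rw [real_inner_smul_left, flow_inner_integral]
      refine mul_nonneg zero_le_two (intervalIntegral.integral_nonneg ht.le fun s hs => ?_)
      exact (J.mem_cone_iff _).1 (J.flow_mem B hB α hα s hs.1) w
    · intro w hw
      have h0 : ∫ s in (0 : ℝ)..t, ⟪(NormedSpace.exp (s • B)) α, J.mul w w⟫ = 0 := by
        have : ⟪(2 : ℝ) • ∫ s in (0 : ℝ)..t, (NormedSpace.exp (s • B)) α, J.mul w w⟫ = 0 := by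
          rw [inner_sq, hw, inner_zero_left]
        rw [real_inner_smul_left, flow_inner_integral] at this
        simpa using this
      have hin : ∀ s ∈ Icc 0 t, ⟪(NormedSpace.exp (s • B)) α, J.mul w w⟫ = 0 := by
        intro s hs
        have hnn : ∀ s ∈ Icc 0 t, 0 ≤ ⟪(NormedSpace.exp (s • B)) α, J.mul w w⟫ := fun s hs =>
          (J.mem_cone_iff _).1 (J.flow_mem B hB α hα s hs.1) w
        by_contra hne
        have hpos := intervalIntegral.integral_pos ht
          (f := fun s => ⟪(NormedSpace.exp (s • B)) α, J.mul w w⟫)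
          (hcf.inner continuous_const).continuousOn (fun s hs => hnn s ⟨hs.1.le, hs.2⟩)
          ⟨s, hs, lt_of_le_of_ne (hnn s hs) (Ne.symm hne)⟩
        exact hpos.ne' h0
      set u := J.mul w w with hu
      have hk : ∀ k : ℕ, ∀ s ∈ Icc 0 t, J.mul u ((B ^ k) ((NormedSpace.exp (s • B)) α)) = 0 := by
        intro k
        induction k with
        | zero =>
          intro s hs
          refine J.mul_eq_zero_of_inner _ _ (J.sq_mem w) (by simpa using J.flow_mem B hB α hα s hs.1) ?_
          rw [real_inner_comm]
          simpa using hin s hs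
        | succ k ih =>
          let M : V →L[ℝ] V := ((J.mul u).toContinuousLinearMap).comp (B ^ k)
          have hM : ∀ y, M y = J.mul u ((B ^ k) y) := fun y => rfl
          have hM2 : ∀ y, J.mul u ((B ^ (k + 1)) y) = M (B y) := fun y => by
            rw [hM, pow_succ]; rfl
          have hopen : ∀ s ∈ Ioo 0 t, M (B ((NormedSpace.exp (s • B)) α)) = 0 := by
            intro s hs
            have hd := M.hasFDerivAt.comp_hasDerivAt s (hasDerivAt_flow B α s)
            have hz : (M ∘ fun s : ℝ => (NormedSpace.exp (s • B)) α) =ᶠ[𝓝 s] fun _ => 0 := by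
              filter_upwards [Ioo_mem_nhds hs.1 hs.2] with r hr
              exact ih r ⟨hr.1.le, hr.2.le⟩
            exact (hd.congr_of_eventuallyEq hz.symm).unique (hasDerivAt_const s (0 : V))
          intro s hs
          rw [hM2]
          have hcl : IsClosed {s : ℝ | M (B ((NormedSpace.exp (s • B)) α)) = 0} :=
            isClosed_eq (by fun_prop) continuous_const
          have := hcl.closure_subset_iff.2 (show Ioo 0 t ⊆ _ from hopen)
          rw [closure_Ioo ht.ne] at this
          exact this hs
      refine J.sq_eq_zero w (hr u fun k _ => ?_)
      have := hk k 0 ⟨le_rfl, ht.le⟩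
      rw [J.comm]
      simpa using this

end helpers2

end EuclideanJordanAlgebra

/-- Let `V` be a simple Euclidean Jordan algebra of dimension `n`
with cone of squares `K`, `α ∈ K`, and let `B` be a (continuous) linear map with
`⟪B x, u⟫ ≥ 0` for all `u, x ∈ K` with `⟪u, x⟫ = 0`.  Then for every `t > 0` the
element `σ_t = 2 ∫₀ᵗ exp(sB) α ds` lies in the interior of `K` iff the only
`u ∈ V` with `L(Bᵏ α) u = 0` for all `k = 0, …, n − 1` is `u = 0`.  In particular,
`σ_t` lies in the interior of `K` for one `t > 0` iff it does so for all `t > 0`. -/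
theorem sigma_interior_iff_rank
    {V : Type*} [NormedAddCommGroup V] [InnerProductSpace ℝ V] [FiniteDimensional ℝ V]
    (J : EuclideanJordanAlgebra V) (hsimple : J.IsSimple)
    (n : ℕ) (hn : Module.finrank ℝ V = n)
    (α : V) (hα : α ∈ J.cone)
    (B : V →L[ℝ] V)
    (hB : ∀ u ∈ J.cone, ∀ x ∈ J.cone, ⟪u, x⟫ = 0 → 0 ≤ ⟪B x, u⟫) :
    (∀ t : ℝ, 0 < t →
      (((2 : ℝ) • ∫ s in (0 : ℝ)..t, (NormedSpace.exp (s • B)) α) ∈ interior J.cone ↔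
        ∀ u : V, (∀ k : ℕ, k < n → J.mul ((B ^ k) α) u = 0) → u = 0)) ∧
    ∀ s t : ℝ, 0 < s → 0 < t →
      (((2 : ℝ) • ∫ σ in (0 : ℝ)..s, (NormedSpace.exp (σ • B)) α) ∈ interior J.cone ↔
        ((2 : ℝ) • ∫ σ in (0 : ℝ)..t, (NormedSpace.exp (σ • B)) α) ∈ interior J.cone) := by
  have key := J.iff_rank n hn α hα B hB
  exact ⟨key, fun s t hs ht => (key s hs).trans (key t ht).symm⟩
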